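/- arXiv:1505.04115 — 4 statements merged into one kernel-verified Lean document; each statement's English description precedes it below -/
import Mathlib

section
/- Let n ≥ 2 be an integer. There exists a constant C = C(n) > 0 such that for every q ∈ (0,1) one has Σ_{k=1}^∞ k^{(n-3)/2} q^{√k} ≤ C · q · (1-q)^{1-n}. -/
open Real

lemma aux_term (d : ℕ) (q : ℝ) (h0 : 0 < q) (h1 : q < 1) (k m : ℕ) (hm : 0 < m)
    (hk1 : m ^ 2 ≤ k) (hk2 : k < (m + 1) ^ 2) :
    (k : ℝ) ^ ((((d + 2 : ℕ) : ℝ) - 3) / 2) * q ^ Real.sqrt k ≤ (2 * m : ℝ) ^ d * q ^ m / m := by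
  have hm' : (0 : ℝ) < m := by exact_mod_cast hm
  have hm1 : (1 : ℝ) ≤ m := by exact_mod_cast hm
  have hk1' : (m : ℝ) ^ 2 ≤ k := by exact_mod_cast hk1
  have hk2' : (k : ℝ) ≤ (m + 1) ^ 2 := by exact_mod_cast hk2.le
  have hk0 : (0 : ℝ) ≤ k := by positivity
  have hs1 : (m : ℝ) ≤ Real.sqrt k := Real.le_sqrt_of_sq_le hk1'
  have hs2 : Real.sqrt k ≤ 2 * m := by
    refine (Real.sqrt_le_left (by positivity)).2 ?_ |>.trans (by linarith : (m : ℝ) + 1 ≤ 2 * m)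
    exact hk2'
  have hs0 : 0 < Real.sqrt k := lt_of_lt_of_le hm' hs1
  have e1 : (k : ℝ) ^ ((((d + 2 : ℕ) : ℝ) - 3) / 2) = Real.sqrt k ^ d / Real.sqrt k := by
    rw [← Real.rpow_natCast, ← Real.rpow_sub_one hs0.ne', Real.sqrt_eq_rpow, ← Real.rpow_mul hk0]
    congr 1
    push_cast
    ring
  have e2 : q ^ Real.sqrt k ≤ q ^ m := by
    rw [← Real.rpow_natCast q m]
    exact Real.rpow_le_rpow_of_exponent_ge h0 h1.le hs1
  rw [e1, mul_div_right_comm]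
  gcongr

lemma aux_geom (d : ℕ) (q : ℝ) (h0 : 0 < q) (h1 : q < 1) (v : Finset ℕ) :
    ∑ j ∈ v, ((j + 1 : ℕ) : ℝ) ^ d * q ^ (j + 1) ≤ d.factorial * q * (1 / (1 - q) ^ (d + 1)) := by
  have hq : ‖q‖ < 1 := by rw [Real.norm_of_nonneg h0.le]; exact h1
  rw [← tsum_choose_mul_geometric_of_norm_lt_one d hq]
  have hs := summable_choose_mul_geometric_of_norm_lt_one d hq
  calc _ ≤ ∑ j ∈ v, d.factorial * q * (((j + d).choose d : ℕ) * q ^ j) := by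
        refine Finset.sum_le_sum fun j _ => ?_
        have h : (j + 1) ^ d ≤ d.factorial * (j + d).choose d := by
          rw [← Nat.ascFactorial_eq_factorial_mul_choose]
          exact Nat.pow_succ_le_ascFactorial _ _
        have h' : ((j + 1 : ℕ) : ℝ) ^ d ≤ d.factorial * ((j + d).choose d : ℕ) := by
          exact_mod_cast h
        calc _ ≤ (d.factorial * ((j + d).choose d : ℕ) : ℝ) * q ^ (j + 1) := by gcongr
          _ = _ := by ring
    _ = d.factorial * q * ∑ j ∈ v, (((j + d).choose d : ℕ) * q ^ j) := by rw [Finset.mul_sum]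
    _ ≤ _ := by
        gcongr
        exact hs.sum_le_tsum _ (fun i _ => by positivity)

lemma aux_sum (d : ℕ) (q : ℝ) (h0 : 0 < q) (h1 : q < 1) (u : Finset ℕ+) :
    ∑ k ∈ u, ((k : ℕ) : ℝ) ^ ((((d + 2 : ℕ) : ℝ) - 3) / 2) * q ^ Real.sqrt (k : ℕ) ≤
      3 * 2 ^ d * (d.factorial * q * (1 / (1 - q) ^ (d + 1))) := by
  classical
  rw [← Finset.sum_fiberwise_of_maps_to (t := u.image fun k : ℕ+ => Nat.sqrt k - 1)
    (g := fun k : ℕ+ => Nat.sqrt k - 1) (fun x hx => Finset.mem_image_of_mem _ hx)]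
  refine le_trans ?_ (mul_le_mul_of_nonneg_left
    (aux_geom d q h0 h1 (u.image fun k : ℕ+ => Nat.sqrt k - 1)) (by positivity))
  rw [Finset.mul_sum]
  refine Finset.sum_le_sum fun j _ => ?_
  have key : ∀ k : ℕ+, Nat.sqrt k - 1 = j → (j + 1) ^ 2 ≤ (k : ℕ) ∧ (k : ℕ) < (j + 1 + 1) ^ 2 := by
    intro k hk
    have hp : 0 < Nat.sqrt k := Nat.sqrt_pos.2 k.pos
    have : Nat.sqrt k = j + 1 := by omega
    rw [← this]
    exact ⟨Nat.sqrt_le' _, Nat.lt_succ_sqrt' _⟩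
  have hcard : (u.filter fun k : ℕ+ => Nat.sqrt k - 1 = j).card ≤ 3 * (j + 1) := by
    calc _ ≤ (Finset.Ico ((j + 1) ^ 2) ((j + 1 + 1) ^ 2)).card := by
          refine Finset.card_le_card_of_injOn (fun k : ℕ+ => (k : ℕ)) ?_ ?_
          · intro k hk
            have hk' := (Finset.mem_filter.1 hk).2
            simpa using key k hk'
          · exact fun a _ b _ h => PNat.coe_injective h
      _ ≤ _ := by
          rw [Nat.card_Ico, Nat.sub_le_iff_le_add]
          nlinarith
  have hcard' : ((u.filter fun k : ℕ+ => Nat.sqrt k - 1 = j).card : ℝ) ≤ 3 * ((j + 1 : ℕ) : ℝ) := by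
    exact_mod_cast hcard
  have hj : (0 : ℝ) < ((j + 1 : ℕ) : ℝ) := by positivity
  calc _ ≤ (u.filter fun k : ℕ+ => Nat.sqrt k - 1 = j).card •
        ((2 * ((j + 1 : ℕ) : ℝ)) ^ d * q ^ (j + 1) / ((j + 1 : ℕ) : ℝ)) := by
        refine Finset.sum_le_card_nsmul _ _ _ fun k hk => ?_
        have hk' := key k (Finset.mem_filter.1 hk).2
        exact aux_term d q h0 h1 k (j + 1) (by omega) hk'.1 hk'.2
    _ ≤ (3 * ((j + 1 : ℕ) : ℝ)) *
        ((2 * ((j + 1 : ℕ) : ℝ)) ^ d * q ^ (j + 1) / ((j + 1 : ℕ) : ℝ)) := by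
        rw [nsmul_eq_mul]
        gcongr
    _ = _ := by
        rw [mul_pow]
        field_simp

/-- Let `n ≥ 2` be an integer. There exists a constant `C = C(n) > 0` such that for every
`q ∈ (0,1)` one has `Σ_{k=1}^∞ k^((n-3)/2) q^(√k) ≤ C · q · (1-q)^(1-n)`. -/
theorem stmt_0 (n : ℕ) (hn : 2 ≤ n) :
    ∃ C : ℝ, 0 < C ∧ ∀ q : ℝ, q ∈ Set.Ioo (0 : ℝ) 1 →
      Summable (fun k : ℕ+ => ((k : ℕ) : ℝ) ^ (((n : ℝ) - 3) / 2) * q ^ Real.sqrt (k : ℕ)) ∧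
      ∑' k : ℕ+, ((k : ℕ) : ℝ) ^ (((n : ℝ) - 3) / 2) * q ^ Real.sqrt (k : ℕ) ≤
        C * q * (1 - q) ^ ((1 : ℝ) - n) := by
  obtain ⟨d, rfl⟩ : ∃ d, n = d + 2 := ⟨n - 2, by omega⟩
  refine ⟨3 * 2 ^ d * d.factorial, by positivity, ?_⟩
  rintro q ⟨h0, h1⟩
  have hnn : ∀ k : ℕ+, 0 ≤ ((k : ℕ) : ℝ) ^ ((((d + 2 : ℕ) : ℝ) - 3) / 2) *
      q ^ Real.sqrt (k : ℕ) := fun k => by positivity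
  have hs := summable_of_sum_le hnn (aux_sum d q h0 h1)
  refine ⟨hs, (hs.tsum_le_of_sum_le (aux_sum d q h0 h1)).trans (le_of_eq ?_)⟩
  have : (1 - q) ^ ((1 : ℝ) - (d + 2 : ℕ)) = 1 / (1 - q) ^ (d + 1) := by
    rw [one_div, ← Real.rpow_natCast, ← Real.rpow_neg (by linarith)]
    congr 1
    push_cast
    ring
  rw [this]
  ring
end

section
/- Let T > 0. There exists a constant C > 0 (depending only on T) such that for every r > 0 one has ( Σ_{k=1}^∞ e^{−2√(πk/T) · r} )^{1/2} ≤ C · r^{−1} · e^{−(1/2)√(π/T) · r}. -/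
open Real

lemma aux_exp (y : ℝ) (hy : 0 ≤ y) : Real.exp (-y) ≤ 64 / (1 + y ^ 2) ^ 2 := by
  have h1 : 1 ≤ Real.exp y := Real.one_le_exp hy
  have h2 := Real.pow_div_factorial_le_exp y hy 4
  have h3 : ((Nat.factorial 4 : ℕ) : ℝ) = 24 := by norm_num [Nat.factorial]
  rw [h3] at h2
  rw [Real.exp_neg, le_div_iff₀ (by positivity), inv_mul_le_iff₀ (Real.exp_pos y)]
  nlinarith [sq_nonneg (y ^ 2 - 1)]

lemma aux_sum_s9 (q : ℝ) (hq : 0 < q) (n : ℕ) :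
    ∑ i ∈ Finset.range n, 1 / (1 + q * ((i : ℝ) + 1)) ^ 2 ≤ q⁻¹ - q⁻¹ / (1 + q * n) := by
  induction n with
  | zero => simp
  | succ n ih =>
    rw [Finset.sum_range_succ]
    have hA : 0 < 1 + q * (n : ℝ) := by positivity
    have hB : 0 < 1 + q * ((n : ℝ) + 1) := by positivity
    have key : 1 / (1 + q * ((n : ℝ) + 1)) ^ 2 ≤
        q⁻¹ / (1 + q * n) - q⁻¹ / (1 + q * ((n : ℝ) + 1)) := by
      have e : q⁻¹ / (1 + q * n) - q⁻¹ / (1 + q * ((n : ℝ) + 1)) =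
          1 / ((1 + q * n) * (1 + q * ((n : ℝ) + 1))) := by
        field_simp
        ring
      rw [e]
      apply one_div_le_one_div_of_le (by positivity)
      rw [sq]
      apply mul_le_mul_of_nonneg_right _ hB.le
      nlinarith
    push_cast
    linarith

/-- Let `T > 0`. There exists a constant `C > 0` (depending only on `T`) such that for every
`r > 0` one has `( Σ_{k=1}^∞ e^(−2√(πk/T)·r) )^(1/2) ≤ C · r⁻¹ · e^(−(1/2)√(π/T)·r)`. -/
theorem stmt_9 (T : ℝ) (hT : 0 < T) :
    ∃ C : ℝ, 0 < C ∧ ∀ r : ℝ, 0 < r →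
      Real.sqrt (∑' k : ℕ+, Real.exp (-2 * Real.sqrt (π * (k : ℕ) / T) * r)) ≤
        C * r⁻¹ * Real.exp (-(1 / 2) * Real.sqrt (π / T) * r) := by
  have ha : 0 < Real.sqrt (π / T) := Real.sqrt_pos.2 (div_pos Real.pi_pos hT)
  set a := Real.sqrt (π / T) with ha_def
  refine ⟨8 / a, by positivity, fun r hr => ?_⟩
  apply Real.sqrt_le_iff.2
  refine ⟨by positivity, ?_⟩
  have hR : (8 / a * r⁻¹ * Real.exp (-(1 / 2) * a * r)) ^ 2 =
      Real.exp (-(a * r)) * 64 * ((a * r) ^ 2)⁻¹ := by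
    have : Real.exp (-(a * r)) = Real.exp (-(1 / 2) * a * r) ^ 2 := by
      rw [← Real.exp_nat_mul]; congr 1; push_cast; ring
    rw [this]; field_simp; norm_num
  rw [hR, tsum_pnat_eq_tsum_succ
    (f := fun k : ℕ => Real.exp (-2 * Real.sqrt (π * (k : ℕ) / T) * r))]
  apply Real.tsum_le_of_sum_range_le (fun n => (Real.exp_pos _).le)
  intro n
  have hterm : ∀ i : ℕ, Real.exp (-2 * Real.sqrt (π * ((i + 1 : ℕ) : ℝ) / T) * r) ≤
      Real.exp (-(a * r)) * 64 * (1 / (1 + (a * r) ^ 2 * ((i : ℝ) + 1)) ^ 2) := by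
    intro i
    have hs : Real.sqrt (π * ((i + 1 : ℕ) : ℝ) / T) = a * Real.sqrt ((i : ℝ) + 1) := by
      rw [ha_def, ← Real.sqrt_mul (by positivity)]; congr 1; push_cast; ring
    have h1 : 1 ≤ Real.sqrt ((i : ℝ) + 1) := by
      rw [Real.one_le_sqrt]; linarith [(Nat.cast_nonneg i : (0 : ℝ) ≤ i)]
    have hsq : Real.sqrt ((i : ℝ) + 1) ^ 2 = (i : ℝ) + 1 := Real.sq_sqrt (by positivity)
    rw [hs]
    have h2 := aux_exp (a * r * Real.sqrt ((i : ℝ) + 1)) (by positivity)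
    rw [mul_pow, hsq] at h2
    have har : 0 < a * r := by positivity
    calc Real.exp (-2 * (a * Real.sqrt ((i : ℝ) + 1)) * r)
        = Real.exp (-(a * r * Real.sqrt ((i : ℝ) + 1))) *
          Real.exp (-(a * r * Real.sqrt ((i : ℝ) + 1))) := by
          rw [← Real.exp_add]; congr 1; ring
      _ ≤ Real.exp (-(a * r)) * (64 / (1 + (a * r) ^ 2 * ((i : ℝ) + 1)) ^ 2) := by
          apply mul_le_mul _ h2 (Real.exp_pos _).le (Real.exp_pos _).le
          apply Real.exp_le_exp.2
          nlinarith
      _ = _ := by ring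
  refine (Finset.sum_le_sum fun i _ => hterm i).trans ?_
  rw [← Finset.mul_sum]
  apply mul_le_mul_of_nonneg_left _ (by positivity)
  refine (aux_sum_s9 _ (by positivity) n).trans ?_
  have : 0 ≤ ((a * r) ^ 2)⁻¹ / (1 + (a * r) ^ 2 * n) := by positivity
  linarith
end

section
/- Let T > 0 and λ := 2π/T. For k ∈ ℤ with k ≠ 0, let μ_k denote the square root of iλk with positive real part, and define Γ_k : ℝ³ ∖ {0} → ℂ by Γ_k(y) = e^{−μ_k|y|}/(4π|y|). Then for every ε > 0 there exists a constant C > 0 such that for all k ∈ ℤ with k ≠ 0 and all y ∈ ℝ³ with |y| ≥ ε, the gradient of Γ_k satisfies |∇Γ_k(y)| ≤ C |k|^{−1} |y|^{−4}. -/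
open Real

/-- Let `T > 0` and `λ := 2π/T`. For `k ∈ ℤ` with `k ≠ 0`, let `μ_k` denote the square root of
`iλk` with positive real part, and define `Γ_k(y) = e^(−μ_k|y|)/(4π|y|)` on `ℝ³ ∖ {0}`. Then for
every `ε > 0` there exists `C > 0` such that for all `k ≠ 0` and all `|y| ≥ ε`, the gradient of
`Γ_k` satisfies `|∇Γ_k(y)| ≤ C |k|⁻¹ |y|⁻⁴`. -/
theorem stmt_11 (T : ℝ) (hT : 0 < T) (lam : ℝ) (hlam : lam = 2 * π / T)
    (μ : ℤ → ℂ)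
    (hμ : ∀ k : ℤ, k ≠ 0 → (μ k) ^ 2 = Complex.I * (lam : ℂ) * (k : ℂ) ∧ 0 < (μ k).re) :
    ∀ ε : ℝ, 0 < ε → ∃ C : ℝ, 0 < C ∧
      ∀ k : ℤ, k ≠ 0 → ∀ y : EuclideanSpace ℝ (Fin 3), ε ≤ ‖y‖ →
        ‖fderiv ℝ
            (fun z : EuclideanSpace ℝ (Fin 3) =>
              Complex.exp (-(μ k) * (‖z‖ : ℂ)) / (((4 * π * ‖z‖ : ℝ) : ℂ))) y‖ ≤
          C * (|(k : ℝ)|)⁻¹ * (‖y‖ ^ 4)⁻¹ := by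
  intro ε hε
  have hlam0 : 0 < lam := by rw [hlam]; positivity
  refine ⟨7 / (π * lam), by positivity, ?_⟩
  intro k hk y hy
  obtain ⟨hsq, hre⟩ := hμ k hk
  have hr : 0 < ‖y‖ := lt_of_lt_of_le hε hy
  have hy0 : y ≠ 0 := norm_pos_iff.mp hr
  set m := μ k with hm
  set r := ‖y‖ with hrdef
  set a := m.re with ha
  have h1 : a ^ 2 - m.im ^ 2 = 0 := by
    have := congrArg Complex.re hsq
    simp [pow_two] at this
    nlinarith [this]
  have h2 : 2 * a * m.im = lam * k := by
    have := congrArg Complex.im hsq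
    simp [pow_two] at this
    nlinarith [this]
  have him : |m.im| = a := by
    have h : |m.im| = |a| := (sq_eq_sq_iff_abs_eq_abs _ _).mp (by linarith)
    rw [h, abs_of_pos hre]
  have hka : 2 * a ^ 2 = lam * |(k : ℝ)| := by
    have h := congrArg abs h2
    rw [abs_mul, abs_mul, abs_mul, abs_of_pos hre, him, abs_of_pos hlam0] at h
    norm_num at h
    nlinarith [h]
  have hmn : ‖m‖ ≤ 2 * a := by
    have h := Complex.norm_le_abs_re_add_abs_im m
    rw [him, abs_of_pos hre] at h
    linarith
  have hg : HasDerivAt (fun t : ℝ => Complex.exp (-m * (t : ℂ)) / (((4 * π * t : ℝ) : ℂ)))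
      (-(m + (r : ℂ)⁻¹) * Complex.exp (-m * (r : ℂ)) / ((4 * π * r : ℝ) : ℂ)) r := by
    have hid : HasDerivAt (fun t : ℝ => (t : ℂ)) 1 r := Complex.ofRealCLM.hasDerivAt
    have hn := (hid.const_mul (-m)).cexp
    have hd : HasDerivAt (fun t : ℝ => ((4 * π * t : ℝ) : ℂ)) (4 * π) r := by
      have := hid.const_mul (4 * π : ℂ)
      simpa using this
    have hrC : (r : ℂ) ≠ 0 := by exact_mod_cast hr.ne'
    have hpC : (π : ℂ) ≠ 0 := by exact_mod_cast Real.pi_ne_zero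
    have h0 : ((4 * π * r : ℝ) : ℂ) ≠ 0 := by
      push_cast
      simp [hrC, hpC]
    have hq := hn.div hd h0
    have he : (Complex.exp (-m * (r : ℂ)) * (-m * 1) * ((4 * π * r : ℝ) : ℂ) -
        Complex.exp (-m * (r : ℂ)) * (4 * π)) / ((4 * π * r : ℝ) : ℂ) ^ 2 =
        -(m + (r : ℂ)⁻¹) * Complex.exp (-m * (r : ℂ)) / ((4 * π * r : ℝ) : ℂ) := by
      push_cast
      field_simp
      ring
    rw [he] at hq
    exact hq
  have hnd : DifferentiableAt ℝ (fun z : EuclideanSpace ℝ (Fin 3) => ‖z‖) y :=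
    differentiableAt_id.norm ℝ hy0
  have hn1 : ‖fderiv ℝ (fun z : EuclideanSpace ℝ (Fin 3) => ‖z‖) y‖ ≤ 1 := by
    have := norm_fderiv_le_of_lipschitz ℝ (x₀ := y)
      (lipschitzWith_one_norm (E := EuclideanSpace ℝ (Fin 3)))
    simpa using this
  have hcomp := (hg.hasFDerivAt.comp y hnd.hasFDerivAt).fderiv
  have hb : ‖fderiv ℝ (fun z : EuclideanSpace ℝ (Fin 3) =>
      Complex.exp (-m * (‖z‖ : ℂ)) / (((4 * π * ‖z‖ : ℝ) : ℂ))) y‖ ≤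
      ‖-(m + (r : ℂ)⁻¹) * Complex.exp (-m * (r : ℂ)) / ((4 * π * r : ℝ) : ℂ)‖ := by
    change ‖fderiv ℝ ((fun t : ℝ => Complex.exp (-m * (t : ℂ)) / (((4 * π * t : ℝ) : ℂ))) ∘
      (fun z : EuclideanSpace ℝ (Fin 3) => ‖z‖)) y‖ ≤ _
    rw [hcomp]
    refine (ContinuousLinearMap.opNorm_comp_le _ _).trans ?_
    refine (mul_le_of_le_one_right (norm_nonneg _) hn1).trans ?_
    simp
  refine hb.trans ?_
  have hv : ‖-(m + (r : ℂ)⁻¹) * Complex.exp (-m * (r : ℂ)) / ((4 * π * r : ℝ) : ℂ)‖ ≤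
      (2 * a + r⁻¹) * Real.exp (-(a * r)) / (4 * π * r) := by
    rw [norm_div, norm_mul, norm_neg, Complex.norm_exp, Complex.norm_real, Real.norm_eq_abs,
      abs_of_pos (by positivity : 0 < 4 * π * r)]
    have e1 : (-m * (r : ℂ)).re = -(a * r) := by simp [ha]
    have e2 : ‖m + (r : ℂ)⁻¹‖ ≤ 2 * a + r⁻¹ := by
      refine (norm_add_le _ _).trans ?_
      have : ‖(r : ℂ)⁻¹‖ = r⁻¹ := by
        rw [norm_inv, Complex.norm_real, Real.norm_eq_abs, abs_of_pos hr]
      rw [this]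
      linarith
    rw [e1]
    gcongr
  refine hv.trans ?_
  have hkpos : 0 < |(k : ℝ)| := abs_pos.mpr (by exact_mod_cast hk)
  have hx : 0 ≤ a * r := by positivity
  have hE : 2 * (a * r) ^ 3 + (a * r) ^ 2 ≤ 14 * Real.exp (a * r) := by
    have p3 := Real.pow_div_factorial_le_exp (a * r) hx 3
    have p2 := Real.pow_div_factorial_le_exp (a * r) hx 2
    norm_num [Nat.factorial] at p3 p2
    linarith
  have hk2 : |(k : ℝ)| = 2 * a ^ 2 / lam := by
    field_simp
    linarith
  rw [hk2, Real.exp_neg]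
  have hL : (2 * a + r⁻¹) * (Real.exp (a * r))⁻¹ / (4 * π * r) =
      (2 * (a * r) ^ 3 + (a * r) ^ 2) * ((Real.exp (a * r))⁻¹ / (4 * π * r ^ 4 * a ^ 2)) := by
    field_simp
  have hR : 7 / (π * lam) * (2 * a ^ 2 / lam)⁻¹ * (r ^ 4)⁻¹ =
      (14 * Real.exp (a * r)) * ((Real.exp (a * r))⁻¹ / (4 * π * r ^ 4 * a ^ 2)) := by
    field_simp
    norm_num
  rw [hL, hR]
  exact mul_le_mul_of_nonneg_right hE (by positivity)
end

section
/- Let T > 0 and λ := 2π/T. For k ∈ ℤ with k ≠ 0, let μ_k denote the square root of iλk with positive real part, and define Γ_k : ℝ³ ∖ {0} → ℂ by Γ_k(y) = e^{−μ_k|y|}/(4π|y|). Then for every ε > 0 there exists a constant C > 0 such that for all k ∈ ℤ with k ≠ 0, all indices i, j ∈ {1, 2, 3}, and all x ∈ ℝ³ with |x| ≥ ε, the function y ↦ ((x_i − y_i)/(4π|x−y|³)) · ∂_j Γ_k(y) is integrable on ℝ³ and | ∫_{ℝ³} ((x_i − y_i)/(4π|x−y|³)) ∂_j Γ_k(y)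 dy | ≤ C |k|^{−1} |x|^{−3}. -/
open Real MeasureTheory

/-- The ambient space. -/
abbrev E3 := EuclideanSpace ℝ (Fin 3)

/-- Radial majorant of `|y| |∇Γ(y)|`. -/
noncomputable def majF (m : ℝ) (y : E3) : ℝ := (m + 1 / ‖y‖) * Real.exp (-(m / 2) * ‖y‖)

/-- Truncated inverse square. -/
noncomputable def trH (z : E3) : ℝ := if ‖z‖ < 1 then (‖z‖ ^ 2)⁻¹ else 0

/-- The gradient kernel of the Laplacian. -/
noncomputable def kerK (i : Fin 3) (z : E3) : ℝ := z i / (4 * π * ‖z‖ ^ 3)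

lemma integrable_radial (p : ℕ) (hp : p ≤ 2) (b : ℝ) (hb : 0 < b) :
    Integrable (fun y : E3 => (‖y‖ ^ p)⁻¹ * Real.exp (-b * ‖y‖)) := by
  have h := (integrable_fun_norm_addHaar (volume : Measure E3)
    (f := fun r : ℝ => (r ^ p)⁻¹ * Real.exp (-b * r)))
  refine h.2 ?_
  have h2 := integrableOn_rpow_mul_exp_neg_mul_rpow (p := 1) (s := ((2 - p : ℕ) : ℝ)) (b := b)
    (by have : (0:ℝ) ≤ ((2 - p : ℕ) : ℝ) := Nat.cast_nonneg _
        linarith) one_pos hb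
  refine h2.congr_fun ?_ measurableSet_Ioi
  intro r hr
  have hr : 0 < r := hr
  simp only [Real.rpow_natCast, Real.rpow_one, finrank_euclideanSpace, Fintype.card_fin,
    smul_eq_mul, ← mul_assoc]
  congr 1
  interval_cases p
  · simp
  · rw [show 3 - 1 = 2 from rfl, pow_one, pow_two]
    field_simp
  · field_simp
    norm_num

lemma integrable_trH : Integrable trH := by
  have h := (integrable_fun_norm_addHaar (volume : Measure E3)
    (f := fun r : ℝ => if r < 1 then (r ^ 2)⁻¹ else 0))
  refine h.2 ?_
  have h2 : IntegrableOn (Set.indicator (Set.Iio (1:ℝ)) (fun _ => (1:ℝ))) (Set.Ioi 0) := by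
    rw [IntegrableOn, integrable_indicator_iff measurableSet_Iio, IntegrableOn,
      Measure.restrict_restrict measurableSet_Iio]
    refine integrableOn_const (hs := ?_)
    rw [Set.inter_comm, Set.Ioi_inter_Iio]
    simp
  refine h2.congr_fun ?_ measurableSet_Ioi
  intro r hr
  have hr : 0 < r := hr
  by_cases h1 : r < 1
  · simp [h1, Set.indicator, hr.ne']
  · simp [h1, Set.indicator]

lemma integrable_majF (m : ℝ) (hm : 0 < m) : Integrable (majF m) := by
  have h0 := (integrable_radial 0 (by norm_num) (m / 2) (by positivity)).const_mul m
  have h1 := (integrable_radial 1 (by norm_num) (m / 2) (by positivity))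
  refine (h0.add h1).congr (Filter.Eventually.of_forall fun y => ?_)
  simp only [Pi.add_apply, majF]
  rw [pow_zero, pow_one]; ring

lemma integrable_majF_div (m : ℝ) (hm : 0 < m) : Integrable (fun y => majF m y * ‖y‖⁻¹) := by
  have h0 := (integrable_radial 1 (by norm_num) (m / 2) (by positivity)).const_mul m
  have h1 := (integrable_radial 2 (by norm_num) (m / 2) (by positivity))
  refine (h0.add h1).congr (Filter.Eventually.of_forall fun y => ?_)
  simp only [Pi.add_apply, majF]
  rw [pow_one, ← inv_pow, one_div]; ring

lemma integral_majF (m : ℝ) (hm : 0 < m) : ∫ y, majF m y = (m ^ 2)⁻¹ * ∫ y, majF 1 y := by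
  have h : ∀ y, majF m y = m * majF 1 (m • y) := by
    intro y
    simp only [majF, norm_smul, Real.norm_eq_abs, abs_of_pos hm]
    rw [show -(m / 2) * ‖y‖ = -(1 / 2) * (m * ‖y‖) by ring]
    field_simp
  simp_rw [h]
  rw [integral_const_mul, Measure.integral_comp_smul, finrank_euclideanSpace, Fintype.card_fin,
    abs_of_pos (by positivity), smul_eq_mul]
  field_simp

lemma integral_trH (R : ℝ) (hR : 0 < R) (x : E3) :
    Integrable (fun y => trH (R⁻¹ • (x - y))) ∧
    ∫ y, trH (R⁻¹ • (x - y)) = R ^ 3 * ∫ y, trH y := by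
  constructor
  · exact (integrable_trH.comp_smul (R := R⁻¹) (by positivity)).comp_sub_left x
  · rw [integral_sub_left_eq_self (fun y => trH (R⁻¹ • y)), Measure.integral_comp_smul,
      finrank_euclideanSpace, Fintype.card_fin, abs_of_pos (by positivity), smul_eq_mul]
    field_simp

lemma majF_nonneg (m : ℝ) (hm : 0 < m) (y : E3) : 0 ≤ majF m y := by
  unfold majF; positivity

lemma majF_le (m : ℝ) (hm : 0 < m) (y : E3) (hy : y ≠ 0) :
    majF m y ≤ 56 * (m ^ 2)⁻¹ * (‖y‖ ^ 3)⁻¹ := by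
  have hr : 0 < ‖y‖ := norm_pos_iff.2 hy
  unfold majF
  set r := ‖y‖
  have ht : 0 ≤ m / 2 * r := by positivity
  have h2 := Real.pow_div_factorial_le_exp _ ht 2
  have h3 := Real.pow_div_factorial_le_exp _ ht 3
  rw [show -(m / 2) * r = -(m / 2 * r) by ring, Real.exp_neg]
  have he := Real.exp_pos (m / 2 * r)
  simp only [Nat.factorial] at h2 h3
  norm_num at h2 h3
  rw [← sub_nonneg]
  have : 56 * (m ^ 2)⁻¹ * (r ^ 3)⁻¹ - (m + 1 / r) * (rexp (m / 2 * r))⁻¹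
    = (56 * rexp (m / 2 * r) - ((m * r) ^ 3 + (m * r) ^ 2)) / (m ^ 2 * r ^ 3 * rexp (m / 2 * r)) := by
    field_simp
  rw [this]
  apply div_nonneg _ (by positivity)
  nlinarith

lemma kerK_sub (i : Fin 3) (a b : E3) (ha : a ≠ 0) (hb : b ≠ 0) :
    |kerK i a - kerK i b| ≤ ‖a - b‖ * ((‖a‖ ^ 2)⁻¹ * ‖b‖⁻¹ + ‖a‖⁻¹ * (‖b‖ ^ 2)⁻¹) := by
  have hA : 0 < ‖a‖ := norm_pos_iff.2 ha
  have hB : 0 < ‖b‖ := norm_pos_iff.2 hb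
  have h := dist_div_norm_sq_smul ha hb 1
  rw [dist_eq_norm, dist_eq_norm] at h
  have hi := PiLp.norm_apply_le ((1 / ‖a‖) ^ 2 • a - (1 / ‖b‖) ^ 2 • b) i
  rw [h] at hi
  simp only [PiLp.sub_apply, PiLp.smul_apply, smul_eq_mul, Real.norm_eq_abs] at hi
  have hbi := PiLp.norm_apply_le b i
  rw [Real.norm_eq_abs] at hbi
  have hn : |‖a‖ - ‖b‖| ≤ ‖a - b‖ := abs_norm_sub_norm_le a b
  have hpi : 1 ≤ 4 * π := by nlinarith [Real.pi_gt_three]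
  have e : kerK i a - kerK i b = (4 * π)⁻¹ * (‖a‖⁻¹ * ((1 / ‖a‖) ^ 2 * a i - (1 / ‖b‖) ^ 2 * b i)
      - b i * ((‖a‖ - ‖b‖) * (‖a‖⁻¹ * (‖b‖ ^ 3)⁻¹))) := by
    unfold kerK
    field_simp
    ring
  rw [e, abs_mul, abs_of_pos (by positivity)]
  have h1 : |‖a‖⁻¹ * ((1 / ‖a‖) ^ 2 * a i - (1 / ‖b‖) ^ 2 * b i)
      - b i * ((‖a‖ - ‖b‖) * (‖a‖⁻¹ * (‖b‖ ^ 3)⁻¹))| ≤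
      ‖a‖⁻¹ * (1 ^ 2 / (‖a‖ * ‖b‖) * ‖a - b‖) + ‖b‖ * (‖a - b‖ * (‖a‖⁻¹ * (‖b‖ ^ 3)⁻¹)) := by
    refine (abs_sub _ _).trans (add_le_add ?_ ?_)
    · rw [abs_mul, abs_of_pos (inv_pos.2 hA)]
      gcongr
    · rw [abs_mul, abs_mul, abs_of_pos (a := ‖a‖⁻¹ * (‖b‖ ^ 3)⁻¹) (by positivity)]
      gcongr
  calc _ ≤ 1 * |‖a‖⁻¹ * ((1 / ‖a‖) ^ 2 * a i - (1 / ‖b‖) ^ 2 * b i)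
      - b i * ((‖a‖ - ‖b‖) * (‖a‖⁻¹ * (‖b‖ ^ 3)⁻¹))| := by
        refine mul_le_mul_of_nonneg_right ?_ (abs_nonneg _)
        exact inv_le_one_of_one_le₀ hpi
    _ ≤ _ := by
        rw [one_mul]
        refine h1.trans (le_of_eq ?_)
        field_simp

/-- The fundamental solution. -/
noncomputable def gam (c : ℂ) (z : E3) : ℂ :=
  Complex.exp (-c * (‖z‖ : ℂ)) / (((4 * π * ‖z‖ : ℝ) : ℂ))

lemma gam_fderiv_le (c : ℂ) (hc : ‖c‖ / 2 ≤ c.re) (j : Fin 3) (y : E3) (hy : y ≠ 0) :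
    ‖fderiv ℝ (gam c) y (EuclideanSpace.single j (1 : ℝ))‖ ≤ majF ‖c‖ y * ‖y‖⁻¹ := by
  have hr : 0 < ‖y‖ := norm_pos_iff.2 hy
  have hrc : ((‖y‖ : ℝ) : ℂ) ≠ 0 := by exact_mod_cast hr.ne'
  have hpc : (π : ℂ) ≠ 0 := by exact_mod_cast Real.pi_ne_zero
  have hn : DifferentiableAt ℝ (fun z : E3 => ‖z‖) y := differentiableAt_id.norm ℝ hy
  have hg : HasDerivAt (fun r : ℝ => Complex.exp (-c * (r : ℂ)) / (((4 * π * r : ℝ) : ℂ)))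
      (-(4 * π : ℂ)⁻¹ * (c + 1 / ‖y‖) * Complex.exp (-c * (‖y‖ : ℂ)) / ‖y‖) ‖y‖ := by
    have h1 : HasDerivAt (fun r : ℂ => Complex.exp (-c * r) / (4 * π * r))
      (-(4 * π : ℂ)⁻¹ * (c + 1 / ‖y‖) * Complex.exp (-c * (‖y‖ : ℂ)) / ‖y‖) (‖y‖ : ℂ) := by
      have := (((hasDerivAt_id ((‖y‖ : ℝ) : ℂ)).const_mul (-c)).cexp).div
        ((hasDerivAt_id ((‖y‖ : ℝ) : ℂ)).const_mul (4 * π : ℂ)) (by simp [hpc]; exact hy)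
      refine HasDerivAt.congr_deriv this ?_
      simp only [id]
      field_simp
      ring
    have h2 := h1.comp_ofReal
    simpa using h2
  have hf := (hg.hasFDerivAt.comp y hn.hasFDerivAt).fderiv
  have : gam c = (fun r : ℝ => Complex.exp (-c * (r : ℂ)) / (((4 * π * r : ℝ) : ℂ))) ∘ 
    (fun z : E3 => ‖z‖) := rfl
  rw [this, hf]
  simp only [ContinuousLinearMap.comp_apply, ContinuousLinearMap.toSpanSingleton_apply]
  rw [norm_smul]
  have hl : ‖fderiv ℝ (fun z : E3 => ‖z‖) y (EuclideanSpace.single j (1 : ℝ))‖ ≤ 1 := by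
    refine (ContinuousLinearMap.le_opNorm _ _).trans ?_
    have := norm_fderiv_le_of_lipschitz ℝ (x₀ := y) (lipschitzWith_one_norm (E := E3))
    simpa using this
  have hpi : 1 ≤ 4 * π := by nlinarith [Real.pi_gt_three]
  have hb : ‖-(4 * π : ℂ)⁻¹ * (c + 1 / ‖y‖) * Complex.exp (-c * (‖y‖ : ℂ)) / ‖y‖‖ ≤
      majF ‖c‖ y * ‖y‖⁻¹ := by
    rw [norm_div, norm_mul, norm_mul, norm_neg, norm_inv, Complex.norm_exp, Complex.norm_real,
      norm_norm, div_eq_mul_inv, majF]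
    gcongr ?_ * _
    have h4 : ‖(4 * π : ℂ)‖ = 4 * π := by
      simp [abs_of_pos Real.pi_pos]
    rw [h4]
    have h5 : ‖c + 1 / (‖y‖ : ℂ)‖ ≤ ‖c‖ + 1 / ‖y‖ := by
      refine (norm_add_le _ _).trans (le_of_eq ?_)
      simp
    have h6 : (-c * (‖y‖ : ℂ)).re ≤ -(‖c‖ / 2) * ‖y‖ := by
      simp only [Complex.mul_re, Complex.neg_re, Complex.ofReal_re, Complex.ofReal_im, mul_zero, sub_zero]
      nlinarith
    calc (4 * π)⁻¹ * ‖c + 1 / (‖y‖ : ℂ)‖ * rexp (-c * (‖y‖ : ℂ)).re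
        ≤ 1 * (‖c‖ + 1 / ‖y‖) * rexp (-(‖c‖ / 2) * ‖y‖) := by
          gcongr
          exact inv_le_one_of_one_le₀ hpi
      _ = _ := by ring
  exact (mul_le_of_le_one_left (norm_nonneg _) hl).trans hb

lemma gam_odd (c : ℂ) (v y : E3) : fderiv ℝ (gam c) (-y) v = - fderiv ℝ (gam c) y v := by
  have h : (fun z => gam c (-z)) = gam c := by
    funext z; simp [gam]
  have h2 := fderiv_comp_smul (𝕜 := ℝ) (f := gam c) (x := y) (-1 : ℝ)
  simp only [neg_smul, one_smul] at h2
  rw [h] at h2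
  rw [h2]
  simp

lemma measurable_kerK (i : Fin 3) : Measurable (kerK i) := by
  unfold kerK
  fun_prop

lemma pointwise_bound (c : ℂ) (hc0 : c ≠ 0) (hc : ‖c‖ / 2 ≤ c.re) (i j : Fin 3) (x y : E3)
    (hx : x ≠ 0) (hy : y ≠ 0) (hxy : x - y ≠ 0) :
    ‖((kerK i (x - y) - kerK i x : ℝ) : ℂ) *
      fderiv ℝ (gam c) y (EuclideanSpace.single j (1 : ℝ))‖ ≤
    9 * (‖x‖ ^ 3)⁻¹ * majF ‖c‖ y +
      3584 * (‖c‖ ^ 2)⁻¹ * (‖x‖ ^ 6)⁻¹ * trH ((‖x‖ / 2)⁻¹ • (x - y)) := by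
  have hm : 0 < ‖c‖ := norm_pos_iff.2 hc0
  have hX : 0 < ‖x‖ := norm_pos_iff.2 hx
  have hY : 0 < ‖y‖ := norm_pos_iff.2 hy
  have hD : 0 < ‖x - y‖ := norm_pos_iff.2 hxy
  have h1 := kerK_sub i (x - y) x hxy hx
  rw [show x - y - x = -y by abel, norm_neg] at h1
  have h2 := gam_fderiv_le c hc j y hy
  have hF := majF_nonneg ‖c‖ hm y
  have h3 := majF_le ‖c‖ hm y hy
  set F := majF ‖c‖ y
  set m := ‖c‖
  rw [norm_mul, Complex.norm_real, Real.norm_eq_abs]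
  have step1 : |kerK i (x - y) - kerK i x| *
      ‖fderiv ℝ (gam c) y (EuclideanSpace.single j (1 : ℝ))‖ ≤
      ((‖x - y‖ ^ 2)⁻¹ * ‖x‖⁻¹ + ‖x - y‖⁻¹ * (‖x‖ ^ 2)⁻¹) * F := by
    calc _ ≤ (‖y‖ * ((‖x - y‖ ^ 2)⁻¹ * ‖x‖⁻¹ + ‖x - y‖⁻¹ * (‖x‖ ^ 2)⁻¹)) * (F * ‖y‖⁻¹) := by
          gcongr
      _ = _ := by field_simp
  refine step1.trans ?_
  have step2 : (‖x - y‖ ^ 2)⁻¹ * F ≤ 4 * (‖x‖ ^ 2)⁻¹ * F +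
      1792 * (m ^ 2)⁻¹ * (‖x‖ ^ 5)⁻¹ * trH ((‖x‖ / 2)⁻¹ • (x - y)) := by
    have hnorm : ‖(‖x‖ / 2)⁻¹ • (x - y)‖ = (‖x‖ / 2)⁻¹ * ‖x - y‖ := by
      rw [norm_smul, norm_inv, Real.norm_of_nonneg (by positivity)]
    unfold trH
    rw [hnorm]
    by_cases hlt : ‖x - y‖ < ‖x‖ / 2
    · have hcond : (‖x‖ / 2)⁻¹ * ‖x - y‖ < 1 := by
        rw [inv_mul_lt_iff₀ (by positivity)]; linarith
      rw [if_pos hcond]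
      have hy2 : ‖x‖ / 2 ≤ ‖y‖ := by
        have := norm_sub_norm_le x y
        linarith
      have hF2 : F ≤ 56 * (m ^ 2)⁻¹ * ((‖x‖ / 2) ^ 3)⁻¹ := by
        refine h3.trans ?_
        gcongr
      calc (‖x - y‖ ^ 2)⁻¹ * F ≤ (‖x - y‖ ^ 2)⁻¹ * (56 * (m ^ 2)⁻¹ * ((‖x‖ / 2) ^ 3)⁻¹) := by
            gcongr
        _ = 1792 * (m ^ 2)⁻¹ * (‖x‖ ^ 5)⁻¹ * (((‖x‖ / 2)⁻¹ * ‖x - y‖) ^ 2)⁻¹ := by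
            field_simp
            norm_num
        _ ≤ _ := by
            have : 0 ≤ 4 * (‖x‖ ^ 2)⁻¹ * F := by positivity
            linarith
    · have hcond : ¬ (‖x‖ / 2)⁻¹ * ‖x - y‖ < 1 := by
        rw [inv_mul_lt_iff₀ (by positivity)]; linarith
      rw [if_neg hcond, mul_zero, add_zero]
      gcongr
      push Not at hlt
      calc (‖x - y‖ ^ 2)⁻¹ ≤ ((‖x‖ / 2) ^ 2)⁻¹ := by gcongr
        _ = _ := by field_simp; norm_num
  have amgm : ‖x - y‖⁻¹ * (‖x‖ ^ 2)⁻¹ ≤ (‖x - y‖ ^ 2)⁻¹ * ‖x‖⁻¹ + (‖x‖ ^ 3)⁻¹ := by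
    have hu : 0 < ‖x - y‖⁻¹ := by positivity
    have hv : 0 < ‖x‖⁻¹ := by positivity
    simp only [← inv_pow]
    have : 0 ≤ ‖x‖⁻¹ * (‖x - y‖⁻¹ ^ 2 + ‖x‖⁻¹ ^ 2 - ‖x - y‖⁻¹ * ‖x‖⁻¹) := by
      apply mul_nonneg hv.le
      nlinarith [sq_nonneg (‖x - y‖⁻¹ - ‖x‖⁻¹)]
    nlinarith
  calc _ ≤ ((‖x - y‖ ^ 2)⁻¹ * ‖x‖⁻¹ + ((‖x - y‖ ^ 2)⁻¹ * ‖x‖⁻¹ + (‖x‖ ^ 3)⁻¹)) * F := by gcongr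
    _ = 2 * ‖x‖⁻¹ * ((‖x - y‖ ^ 2)⁻¹ * F) + (‖x‖ ^ 3)⁻¹ * F := by ring
    _ ≤ 2 * ‖x‖⁻¹ * (4 * (‖x‖ ^ 2)⁻¹ * F +
      1792 * (m ^ 2)⁻¹ * (‖x‖ ^ 5)⁻¹ * trH ((‖x‖ / 2)⁻¹ • (x - y))) + (‖x‖ ^ 3)⁻¹ * F := by gcongr
    _ = _ := by
      simp only [← inv_pow]
      ring

lemma main_bound (c : ℂ) (hc0 : c ≠ 0) (hc : ‖c‖ / 2 ≤ c.re) (i j : Fin 3) (x : E3)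
    (hx : x ≠ 0) :
    Integrable (fun y : E3 => ((kerK i (x - y) : ℝ) : ℂ) *
      fderiv ℝ (gam c) y (EuclideanSpace.single j (1 : ℝ))) ∧
    ‖∫ y : E3, ((kerK i (x - y) : ℝ) : ℂ) *
      fderiv ℝ (gam c) y (EuclideanSpace.single j (1 : ℝ))‖ ≤
    (9 * (∫ y, majF 1 y) + 448 * ∫ y, trH y) * (‖c‖ ^ 2)⁻¹ * (‖x‖ ^ 3)⁻¹ := by
  have hm : 0 < ‖c‖ := norm_pos_iff.2 hc0
  have hX : 0 < ‖x‖ := norm_pos_iff.2 hx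
  have ae0 : ∀ᵐ y : E3, y ≠ 0 := by simp [ae_iff]
  have aex : ∀ᵐ y : E3, y ≠ x := by simp [ae_iff]
  set g : E3 → ℂ := fun y => fderiv ℝ (gam c) y (EuclideanSpace.single j (1 : ℝ)) with hg
  have hgm : Measurable g := measurable_fderiv_apply_const ℝ (gam c) _
  have hgi : Integrable g := by
    refine (integrable_majF_div ‖c‖ hm).mono' hgm.aestronglyMeasurable ?_
    filter_upwards [ae0] with y hy
    exact gam_fderiv_le c hc j y hy
  have hg0 : ∫ y, g y = 0 := by
    have h1 := integral_neg_eq_self g (volume : Measure E3)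
    have h2 : ∀ y, g (-y) = - g y := fun y => gam_odd c _ y
    simp only [h2, integral_neg] at h1
    exact self_eq_neg.1 h1.symm
  obtain ⟨hH, hHint⟩ := integral_trH (‖x‖ / 2) (by positivity) x
  have hDint : Integrable (fun y => 9 * (‖x‖ ^ 3)⁻¹ * majF ‖c‖ y +
      3584 * (‖c‖ ^ 2)⁻¹ * (‖x‖ ^ 6)⁻¹ * trH ((‖x‖ / 2)⁻¹ • (x - y))) :=
    ((integrable_majF ‖c‖ hm).const_mul _).add (hH.const_mul _)
  have hb : ∀ᵐ y : E3, ‖((kerK i (x - y) - kerK i x : ℝ) : ℂ) * g y‖ ≤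
      9 * (‖x‖ ^ 3)⁻¹ * majF ‖c‖ y +
      3584 * (‖c‖ ^ 2)⁻¹ * (‖x‖ ^ 6)⁻¹ * trH ((‖x‖ / 2)⁻¹ • (x - y)) := by
    filter_upwards [ae0, aex] with y hy hy2
    exact pointwise_bound c hc0 hc i j x y hx hy (sub_ne_zero.2 (Ne.symm hy2))
  have hkm : Measurable (fun y : E3 => ((kerK i (x - y) - kerK i x : ℝ) : ℂ)) := by
    have := measurable_kerK i
    fun_prop
  have hi1 : Integrable (fun y : E3 => ((kerK i (x - y) - kerK i x : ℝ) : ℂ) * g y) :=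
    hDint.mono' (hkm.mul hgm).aestronglyMeasurable hb
  have hi2 : Integrable (fun y : E3 => ((kerK i x : ℝ) : ℂ) * g y) := hgi.const_mul _
  have heq : (fun y : E3 => ((kerK i (x - y) : ℝ) : ℂ) * g y) =
      fun y => ((kerK i (x - y) - kerK i x : ℝ) : ℂ) * g y + ((kerK i x : ℝ) : ℂ) * g y := by
    funext y
    push_cast
    ring
  refine ⟨?_, ?_⟩
  · rw [heq]; exact hi1.add hi2
  · rw [heq, integral_add hi1 hi2, integral_const_mul, hg0, mul_zero, add_zero]
    refine (norm_integral_le_of_norm_le hDint hb).trans (le_of_eq ?_)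
    rw [integral_add ((integrable_majF ‖c‖ hm).const_mul _) (hH.const_mul _),
      integral_const_mul, integral_const_mul, hHint, integral_majF _ hm]
    field_simp
    ring

/-- Let `T > 0` and `λ := 2π/T`. For `k ∈ ℤ` with `k ≠ 0`, let `μ_k` denote the square root of
`iλk` with positive real part, and define `Γ_k(y) = e^(−μ_k|y|)/(4π|y|)` on `ℝ³ ∖ {0}`. Then
for every `ε > 0` there exists `C > 0` such that for all `k ≠ 0`, all indices `i, j`, and all
`x ∈ ℝ³` with `|x| ≥ ε`, the function `y ↦ ((x_i − y_i)/(4π|x−y|³)) ∂_j Γ_k(y)` is integrable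
on `ℝ³` and `|∫_{ℝ³} ((x_i − y_i)/(4π|x−y|³)) ∂_j Γ_k(y) dy| ≤ C |k|⁻¹ |x|⁻³`. -/
theorem stmt_13 (T : ℝ) (hT : 0 < T) (lam : ℝ) (hlam : lam = 2 * π / T)
    (μ : ℤ → ℂ)
    (hμ : ∀ k : ℤ, k ≠ 0 → (μ k) ^ 2 = Complex.I * (lam : ℂ) * (k : ℂ) ∧ 0 < (μ k).re) :
    ∀ ε : ℝ, 0 < ε → ∃ C : ℝ, 0 < C ∧
      ∀ k : ℤ, k ≠ 0 → ∀ i j : Fin 3, ∀ x : EuclideanSpace ℝ (Fin 3), ε ≤ ‖x‖ →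
        Integrable (fun y : EuclideanSpace ℝ (Fin 3) =>
          (((x i - y i) / (4 * π * ‖x - y‖ ^ 3) : ℝ) : ℂ) *
            fderiv ℝ
              (fun z : EuclideanSpace ℝ (Fin 3) =>
                Complex.exp (-(μ k) * (‖z‖ : ℂ)) / (((4 * π * ‖z‖ : ℝ) : ℂ)))
              y (EuclideanSpace.single j (1 : ℝ))) ∧
        ‖∫ y : EuclideanSpace ℝ (Fin 3),
            (((x i - y i) / (4 * π * ‖x - y‖ ^ 3) : ℝ) : ℂ) *
              fderiv ℝ
                (fun z : EuclideanSpace ℝ (Fin 3) =>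
                  Complex.exp (-(μ k) * (‖z‖ : ℂ)) / (((4 * π * ‖z‖ : ℝ) : ℂ)))
                y (EuclideanSpace.single j (1 : ℝ))‖ ≤
          C * (|(k : ℝ)|)⁻¹ * (‖x‖ ^ 3)⁻¹ := by
  intro ε hε
  have hlam0 : 0 < lam := by rw [hlam]; positivity
  have hA : 0 ≤ ∫ y, majF 1 y := integral_nonneg fun y => majF_nonneg 1 one_pos y
  have hB : 0 ≤ ∫ y, trH y := integral_nonneg fun y => by
    simp only [Pi.zero_apply, trH]
    split_ifs <;> positivity
  refine ⟨(9 * (∫ y, majF 1 y) + 448 * (∫ y, trH y) + 1) * lam⁻¹, by positivity, ?_⟩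
  intro k hk i j x hx
  obtain ⟨hsq, hre⟩ := hμ k hk
  have hX : 0 < ‖x‖ := hε.trans_le hx
  have hc0 : μ k ≠ 0 := by
    intro h
    rw [h] at hre
    simp at hre
  have hnorm : ‖μ k‖ ^ 2 = lam * |(k : ℝ)| := by
    rw [← norm_pow, hsq]
    simp [abs_of_pos hlam0]
  have hc : ‖μ k‖ / 2 ≤ (μ k).re := by
    have h1 := congrArg Complex.re hsq
    have h2 : ‖μ k‖ ^ 2 = (μ k).re * (μ k).re + (μ k).im * (μ k).im := by
      rw [Complex.sq_norm, Complex.normSq_apply]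
    simp [pow_two] at h1
    by_contra hcon
    push Not at hcon
    nlinarith
  obtain ⟨h1, h2⟩ := main_bound (μ k) hc0 hc i j x (norm_pos_iff.1 hX)
  refine ⟨h1, h2.trans ?_⟩
  rw [hnorm, mul_inv, ← mul_assoc]
  gcongr ?_ * _ * _ * _
  linarith
end
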